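/- (Multivariate q-Cauchy formula, probabilistic form.) Let k ≥ 1, and let r, n, x_1,…,x_{k+1} be nonnegative integers with x_1+⋯+x_{k+1} = n and n ≤ r; let q > 0 be real with q ≠ 1. Then [r+k; n+k]_q = Σ q^{Σ_{j=1}^{k}(r_j−x_j)(n−y_j+k−j+1)} · ∏_{j=1}^{k+1}[r_j; x_j]_q, where y_j = x_1+⋯+x_j, the sum is over all integers r_1,…,r_k with x_j ≤ r_j ≤ r and r_1+⋯+r_k ≤ r, and r_{k+1} = r − (r_1+⋯+r_k). -/

import Mathlib

open Finset Filter

noncomputable def qNum (q x : ℝ) : ℝ := (1 - q ^ x) / (1 - q)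

noncomputable def qFact (q x : ℝ) (r : ℕ) : ℝ :=
  ∏ i ∈ Finset.range r, qNum q (x - i)

noncomputable def qFactorial (q : ℝ) (r : ℕ) : ℝ :=
  ∏ i ∈ Finset.range r, qNum q (i + 1)

noncomputable def qBinom (q x : ℝ) (r : ℕ) : ℝ := qFact q x r / qFactorial q r

noncomputable def qMultinom {k : ℕ} (q x : ℝ) (r : Fin k → ℕ) : ℝ :=
  qFact q x (∑ i, r i) / ∏ i, qFactorial q (r i)

theorem qNum_zero (q : ℝ) : qNum q 0 = 0 := by simp [qNum]

theorem qNum_ne_zero {q x : ℝ} (hq0 : 0 < q) (hq1 : q ≠ 1) (hx : x ≠ 0) : qNum q x ≠ 0 := by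
  refine div_ne_zero (fun h => ?_) (sub_ne_zero.2 hq1.symm)
  have hlog := congrArg Real.log (sub_eq_zero.1 h)
  rw [Real.log_one, Real.log_rpow hq0, zero_eq_mul] at hlog
  exact hlog.elim hx (Real.log_ne_zero_of_pos_of_ne_one hq0 hq1)

theorem qFactorial_ne_zero {q : ℝ} (hq0 : 0 < q) (hq1 : q ≠ 1) (r : ℕ) : qFactorial q r ≠ 0 :=
  Finset.prod_ne_zero_iff.2 fun i _ => qNum_ne_zero hq0 hq1 (by positivity)

theorem qBinom_zero_right (q x : ℝ) : qBinom q x 0 = 1 := by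
  simp [qBinom, qFact, qFactorial]

theorem qBinom_natCast_eq_zero_of_lt (q : ℝ) {m j : ℕ} (h : m < j) : qBinom q (m : ℝ) j = 0 := by
  rw [qBinom, qFact, Finset.prod_eq_zero (Finset.mem_range.2 h) (by simp [qNum_zero]), zero_div]

theorem qNum_add {q : ℝ} (hq0 : 0 < q) (x y : ℝ) :
    qNum q (x + y) = q ^ x * qNum q y + qNum q x := by
  simp only [qNum, Real.rpow_add hq0]
  ring

/-- The `q`-Pascal rule for natural upper index, valid for every lower index. -/
theorem qBinom_succ_succ {q : ℝ} (hq0 : 0 < q) (hq1 : q ≠ 1) (m j : ℕ) :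
    qBinom q ((m + 1 : ℕ) : ℝ) (j + 1) =
      q ^ ((m : ℤ) - j) * qBinom q (m : ℝ) j + qBinom q (m : ℝ) (j + 1) := by
  have hfact : qFactorial q (j + 1) = qFactorial q j * qNum q (j + 1) :=
    Finset.prod_range_succ _ _
  have hright : qFact q (m : ℝ) (j + 1) = qFact q m j * qNum q (m - j) :=
    Finset.prod_range_succ _ _
  have hleft : qFact q ((m + 1 : ℕ) : ℝ) (j + 1) = qFact q m j * qNum q (m + 1) := by
    simp [qFact, Finset.prod_range_succ']
  have hnum : qNum q ((m : ℝ) + 1) =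
      q ^ ((m : ℤ) - j) * qNum q ((j : ℝ) + 1) + qNum q ((m : ℝ) - j) := by
    rw [← Real.rpow_intCast]
    push_cast
    rw [← qNum_add hq0]
    congr 1
    ring
  have h₁ := qFactorial_ne_zero hq0 hq1 j
  have h₂ : qNum q ((j : ℝ) + 1) ≠ 0 := qNum_ne_zero hq0 hq1 (by positivity)
  simp only [qBinom, hfact, hright, hleft, hnum]
  field_simp

theorem qBinom_sum_range {q : ℝ} (hq0 : 0 < q) (hq1 : q ≠ 1) (a r : ℕ) :
    ∑ s ∈ Finset.range r, q ^ ((s : ℤ) - a) * qBinom q (s : ℝ) a =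
      qBinom q (r : ℝ) (a + 1) := by
  induction r with
  | zero => rw [qBinom_natCast_eq_zero_of_lt q (Nat.succ_pos a), Finset.sum_range_zero]
  | succ r ih => rw [Finset.sum_range_succ, ih, qBinom_succ_succ hq0 hq1, add_comm]

/-- The bivariate `q`-Cauchy formula, in probabilistic form. -/
theorem qBinom_convolution {q : ℝ} (hq0 : 0 < q) (hq1 : q ≠ 1) (a b r : ℕ) :
    ∑ s ∈ Finset.range (r + 1), q ^ (((s : ℤ) - a) * (b + 1)) *
        (qBinom q (s : ℝ) a * qBinom q ((r - s : ℕ) : ℝ) b) =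
      qBinom q ((r + 1 : ℕ) : ℝ) (a + b + 1) := by
  induction r generalizing b with
  | zero =>
    cases b with
    | zero => simpa [qBinom_zero_right] using qBinom_sum_range hq0 hq1 a 1
    | succ b =>
      rw [qBinom_natCast_eq_zero_of_lt q (by omega)]
      rw [Finset.sum_range_one, Nat.sub_zero,
        qBinom_natCast_eq_zero_of_lt q (Nat.succ_pos b), mul_zero, mul_zero]
  | succ r ih =>
    cases b with
    | zero => simpa [qBinom_zero_right] using qBinom_sum_range hq0 hq1 a (r + 1 + 1)
    | succ b =>
      rw [Finset.sum_range_succ, Nat.sub_self, qBinom_natCast_eq_zero_of_lt q (Nat.succ_pos b),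
        mul_zero, mul_zero, add_zero, ← add_assoc a b 1, qBinom_succ_succ hq0 hq1, ← ih b,
        add_assoc a b 1, ← ih (b + 1), Finset.mul_sum, ← Finset.sum_add_distrib]
      refine Finset.sum_congr rfl fun s hs => ?_
      have hs' : s ≤ r := Nat.lt_succ_iff.1 (Finset.mem_range.1 hs)
      rw [Nat.succ_sub hs', qBinom_succ_succ hq0 hq1]
      have hexp : q ^ (((s : ℤ) - a) * ((b + 1 : ℕ) + 1)) * q ^ (((r - s : ℕ) : ℤ) - b) =
          q ^ (((r + 1 : ℕ) : ℤ) - ((a + (b + 1) : ℕ) : ℤ)) * q ^ (((s : ℤ) - a) * (b + 1)) := by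
        rw [← zpow_add₀ hq0.ne', ← zpow_add₀ hq0.ne']
        congr 1
        push_cast [Nat.cast_sub hs']
        ring
      linear_combination (qBinom q (s : ℝ) a * qBinom q ((r - s : ℕ) : ℝ) b) * hexp

/-- The bivariate formula, summed over any interval that supports the summand. -/
theorem qBinom_convolution_Icc {q : ℝ} (hq0 : 0 < q) (hq1 : q ≠ 1) (a b c r R : ℕ) (hR : r ≤ R)
    (hc : c ≤ b) :
    ∑ s ∈ (Finset.Icc a R).filter (· ≤ r), q ^ (((s : ℤ) - a) * (b + 1)) *
        (qBinom q (s : ℝ) a * qBinom q ((r - s + c : ℕ) : ℝ) b) =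
      qBinom q ((r + c + 1 : ℕ) : ℝ) (a + b + 1) := by
  rw [← qBinom_convolution hq0 hq1]
  refine (Finset.sum_congr rfl fun s hs => ?_).trans (Finset.sum_subset (fun s hs => ?_) ?_)
  · rw [show r - s + c = r + c - s by have := (Finset.mem_filter.1 hs).2; omega]
  · simp only [Finset.mem_filter, Finset.mem_Icc, Finset.mem_range] at hs ⊢
    omega
  · intro s hs hs'
    simp only [Finset.mem_filter, Finset.mem_Icc, Finset.mem_range] at hs hs'
    rcases lt_or_ge s a with h | h
    · simp [qBinom_natCast_eq_zero_of_lt q h]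
    · rw [qBinom_natCast_eq_zero_of_lt q (show r + c - s < b by omega)]
      simp

theorem sum_piFinset_succ_filter {M : Type*} [AddCommMonoid M] {k : ℕ}
    (S : Fin (k + 1) → Finset ℕ) (r : ℕ) (f : (Fin (k + 1) → ℕ) → M) :
    ∑ v ∈ (Fintype.piFinset S).filter (fun v => ∑ i, v i ≤ r), f v =
      ∑ s ∈ (S 0).filter (· ≤ r),
        ∑ w ∈ (Fintype.piFinset fun j => S j.succ).filter (fun w => ∑ i, w i ≤ r - s),
          f (Fin.cons s w) := by
  rw [Finset.sum_sigma']
  refine Finset.sum_bij' (fun v _ => ⟨v 0, Fin.tail v⟩) (fun p _ => Fin.cons p.1 p.2)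
    ?_ ?_ ?_ ?_ ?_
  · intro v hv
    simp only [Finset.mem_filter, Fintype.mem_piFinset, Fin.sum_univ_succ, Finset.mem_sigma,
      Fin.tail] at hv ⊢
    exact ⟨⟨hv.1 0, by omega⟩, fun j => hv.1 j.succ, by omega⟩
  · rintro ⟨s, w⟩ hp
    simp only [Finset.mem_filter, Fintype.mem_piFinset, Fin.sum_univ_succ, Finset.mem_sigma,
      Fin.forall_fin_succ, Fin.cons_zero, Fin.cons_succ] at hp ⊢
    exact ⟨⟨hp.1.1, hp.2.1⟩, by omega⟩
  · simp
  · simp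
  · simp

/-- The multivariate formula with the box bound decoupled from the total `r`. -/
theorem qBinom_multivariate_convolution {q : ℝ} (hq0 : 0 < q) (hq1 : q ≠ 1) (k r R : ℕ)
    (hR : r ≤ R) (x : Fin (k + 1) → ℕ) :
    qBinom q ((r + k : ℕ) : ℝ) (∑ j, x j + k) =
      ∑ v ∈ (Fintype.piFinset fun j : Fin k => Finset.Icc (x j.castSucc) R).filter
          (fun v => ∑ i, v i ≤ r),
        q ^ (∑ j : Fin k,
              ((v j : ℤ) - (x j.castSucc : ℤ)) *
                (((∑ j, x j : ℕ) : ℤ) -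
                    (∑ i ∈ Finset.univ.filter (fun i : Fin (k + 1) => (i : ℕ) ≤ (j : ℕ)),
                      (x i : ℤ)) +
                  ((k : ℤ) - ((j : ℕ) : ℤ)))) *
          ((∏ j : Fin k, qBinom q (v j : ℝ) (x j.castSucc)) *
            qBinom q ((r - ∑ i, v i : ℕ) : ℝ) (x (Fin.last k))) := by
  induction k generalizing r with
  | zero => simp
  | succ k ih =>
    rw [sum_piFinset_succ_filter, Fin.sum_univ_succ x, ← add_assoc r k 1,
      show x 0 + ∑ j : Fin (k + 1), x j.succ + (k + 1) =
        x 0 + (∑ j : Fin (k + 1), x j.succ + k) + 1 by ring,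
      ← qBinom_convolution_Icc hq0 hq1 _ _ k r R hR (Nat.le_add_left _ _)]
    refine Finset.sum_congr rfl fun s hs => ?_
    rw [ih (r - s) ((Nat.sub_le _ _).trans hR) fun j => x j.succ, Finset.mul_sum, Finset.mul_sum]
    refine Finset.sum_congr rfl fun w _ => ?_
    have hhead : ∑ i ∈ Finset.univ.filter
        (fun i : Fin (k + 1 + 1) => (i : ℕ) ≤ ((0 : Fin (k + 1)) : ℕ)), (x i : ℤ) = x 0 := by
      simp [Finset.sum_filter]
    have htail (j : Fin k) : ∑ i ∈ Finset.univ.filter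
          (fun i : Fin (k + 1 + 1) => (i : ℕ) ≤ (j.succ : ℕ)), (x i : ℤ) =
        x 0 + ∑ i ∈ Finset.univ.filter (fun i : Fin (k + 1) => (i : ℕ) ≤ (j : ℕ)),
          (x i.succ : ℤ) := by
      simp [Finset.sum_filter, Fin.sum_univ_succ (n := k + 1)]
    have hexp (j : Fin k) (n : ℕ) :
        ((x 0 + n : ℕ) : ℤ) - ((x 0 : ℤ) + ∑ i ∈ Finset.univ.filter
            (fun i : Fin (k + 1) => (i : ℕ) ≤ (j : ℕ)), (x i.succ : ℤ)) +
          (((k + 1 : ℕ) : ℤ) - ((j.succ : ℕ) : ℤ)) =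
        (n : ℤ) - ∑ i ∈ Finset.univ.filter
            (fun i : Fin (k + 1) => (i : ℕ) ≤ (j : ℕ)), (x i.succ : ℤ) +
          ((k : ℤ) - ((j : ℕ) : ℤ)) := by
      push_cast [Fin.val_succ]
      ring
    have hexp_zero (n : ℕ) :
        ((x 0 + n : ℕ) : ℤ) - (x 0 : ℤ) +
          (((k + 1 : ℕ) : ℤ) - (((0 : Fin (k + 1)) : ℕ) : ℤ)) = ((n + k : ℕ) : ℤ) + 1 := by
      push_cast [Fin.val_zero]
      ring
    have hcons : ∑ i, (Fin.cons s w : Fin (k + 1) → ℕ) i = s + ∑ i, w i := by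
      simp [Fin.sum_univ_succ]
    generalize ∑ j : Fin (k + 1), x j.succ = N
    rw [hcons, Fin.sum_univ_succ (n := k), Fin.prod_univ_succ (n := k)]
    simp only [Fin.cons_zero, Fin.cons_succ, hhead, htail, hexp, hexp_zero,
      zpow_add₀ hq0.ne' (_ * _), ← Fin.succ_castSucc, Fin.castSucc_zero, ← Fin.succ_last,
      Nat.sub_sub]
    ring

/-- Multivariate `q`-Cauchy formula, probabilistic form (2.9b):
`[r+k; n+k]_q = ∑ q^{∑_{j=1}^{k}(r_j−x_j)(n−y_j+k−j+1)} ∏_{j=1}^{k+1}[r_j; x_j]_q`,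
where `y_j = x₁+⋯+x_j`, the sum is over integers `r₁,…,r_k` with `x_j ≤ r_j ≤ r` and
`r₁+⋯+r_k ≤ r`, and `r_{k+1} = r − (r₁+⋯+r_k)`. -/
theorem multivariate_qCauchy_probabilistic
    (k : ℕ) (hk : 1 ≤ k) (r n : ℕ) (x : Fin (k + 1) → ℕ)
    (hx : ∑ j, x j = n) (hnr : n ≤ r)
    (q : ℝ) (hq0 : 0 < q) (hq1 : q ≠ 1) :
    qBinom q ((r : ℝ) + k) (n + k) =
      ∑ v ∈ (Fintype.piFinset fun j : Fin k => Finset.Icc (x j.castSucc) r).filter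
          (fun v => ∑ i, v i ≤ r),
        q ^ (∑ j : Fin k,
              ((v j : ℤ) - (x j.castSucc : ℤ)) *
                ((n : ℤ) -
                    (∑ i ∈ Finset.univ.filter (fun i : Fin (k + 1) => (i : ℕ) ≤ (j : ℕ)),
                      (x i : ℤ)) +
                  ((k : ℤ) - ((j : ℕ) : ℤ)))) *
          ((∏ j : Fin k, qBinom q (v j : ℝ) (x j.castSucc)) *
            qBinom q ((r - ∑ i, v i : ℕ) : ℝ) (x (Fin.last k))) := by
  subst hx
  exact_mod_cast qBinom_multivariate_convolution hq0 hq1 k r r le_rfl x
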